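/- For every ω ∈ ℝ \ {0} and all k, ℓ ∈ ℤ, the dual orthogonality relation holds: ∑_{n=−∞}^{∞} ω^{2n} q^{n(n−1)} [ φ_k(ω q^{n}) φ_ℓ(ω q^{n}) + φ_k(−ω^{−1} q^{−n+1}) φ_ℓ(−ω^{−1} q^{−n+1}) ] = δ_{k,ℓ} · 8 ((q²;q²)_∞² / (q;q²)_∞²) θ_{q²}(−ω²). -/

import Mathlib

open Complex Filter Topology

/-- Finite q-Pochhammer symbol `(a;q)_n`. -/
noncomputable def qp (q a : ℂ) (n : ℕ) : ℂ := ∏ k ∈ Finset.range n, (1 - a * q ^ k)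

/-- Infinite q-Pochhammer symbol `(a;q)_∞`. -/
noncomputable def qpInf (q a : ℂ) : ℂ := ∏' k : ℕ, (1 - a * q ^ k)

/-- Theta function `θ_q(x) = (x;q)_∞ (q/x;q)_∞`. -/
noncomputable def theta (q x : ℂ) : ℂ := qpInf q x * qpInf q (q / x)

/-- The square-summable solution φ_n(x). -/
noncomputable def phi (q : ℝ) (x : ℂ) (n : ℤ) : ℂ :=
  qpInf (q : ℂ) (-1) * x ^ n * (q : ℂ) ^ (n * (n - 1) / 2) *
    ∑' k : ℕ, (q : ℂ) ^ (2 * (k * (k - 1))) *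
      (-((q : ℂ) ^ (-2 * n + 4)) * x ^ (-2 : ℤ)) ^ k /
        qp ((q : ℂ) ^ 2) ((q : ℂ) ^ 2) k

/-- The triangular exponent `n (n - 1) / 2`. -/
def tri (n : ℤ) : ℤ := n * (n - 1) / 2

lemma two_mul_tri (n : ℤ) : 2 * tri n = n * (n - 1) :=
  Int.mul_ediv_cancel' (Int.even_mul_pred_self n).two_dvd

lemma tri_add (m n : ℤ) : tri (m + n) = tri m + tri n + m * n := by
  have h1 := two_mul_tri m
  have h2 := two_mul_tri n
  have h3 := two_mul_tri (m + n)
  linarith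

lemma tri_zero : tri 0 = 0 := rfl

lemma tri_one : tri 1 = 0 := rfl

/-- The Gaussian sequence `c ^ n * Q ^ (n (n - 1) / 2)`. -/
noncomputable def gauss (Q c : ℂ) (n : ℤ) : ℂ := c ^ n * Q ^ tri n

lemma gauss_add {Q c : ℂ} (hQ : Q ≠ 0) (hc : c ≠ 0) (m n : ℤ) :
    gauss Q c (m + n) = gauss Q c m * gauss Q c n * Q ^ (m * n) := by
  simp only [gauss, tri_add, zpow_add₀ hQ, zpow_add₀ hc]
  ring

/-- The coefficients `z ^ r / (Q;Q)_r` of the `q`-exponential series. -/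
noncomputable def qexp (Q z : ℂ) (r : ℕ) : ℂ := z ^ r / qp Q Q r

/-- The coefficients `(-x) ^ r * Q ^ (r (r - 1) / 2) / (Q;Q)_r` of the Euler expansion of
`(x;Q)_∞`. -/
noncomputable def euler (Q x : ℂ) (r : ℕ) : ℂ := gauss Q (-x) r / qp Q Q r

lemma qp_succ (Q a : ℂ) (n : ℕ) : qp Q a (n + 1) = qp Q a n * (1 - a * Q ^ n) :=
  Finset.prod_range_succ _ _

lemma one_sub_pow_ne_zero {Q : ℂ} (hQ1 : ‖Q‖ < 1) (n : ℕ) : 1 - Q * Q ^ n ≠ 0 := by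
  intro h
  have h1 : ‖Q ^ (n + 1)‖ = 1 := by
    rw [pow_succ', ← sub_eq_zero.mp h, norm_one]
  rw [norm_pow] at h1
  exact absurd h1 (pow_lt_one₀ (norm_nonneg _) hQ1 n.succ_ne_zero).ne

lemma qp_ne_zero {Q : ℂ} (hQ1 : ‖Q‖ < 1) (n : ℕ) : qp Q Q n ≠ 0 :=
  Finset.prod_ne_zero_iff.mpr fun k _ => one_sub_pow_ne_zero hQ1 k

lemma tendsto_qp {Q : ℂ} (hQ1 : ‖Q‖ < 1) (a : ℂ) :
    Tendsto (qp Q a) atTop (𝓝 (qpInf Q a)) := by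
  have h : Multipliable fun k : ℕ => 1 + -(a * Q ^ k) := by
    apply multipliable_one_add_of_summable
    simp only [norm_neg, norm_mul, norm_pow]
    exact (summable_geometric_of_lt_one (norm_nonneg _) hQ1).mul_left _
  simp only [← sub_eq_add_neg] at h
  exact h.hasProd.tendsto_prod_nat

lemma qpInf_eq_mul {Q : ℂ} (hQ1 : ‖Q‖ < 1) (a : ℂ) :
    qpInf Q a = (1 - a) * qpInf Q (Q * a) := by
  refine tendsto_nhds_unique ((tendsto_add_atTop_iff_nat 1).mpr (tendsto_qp hQ1 a))
    (((tendsto_qp hQ1 (Q * a)).const_mul (1 - a)).congr fun n => ?_)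
  simp only [qp, Finset.prod_range_succ', pow_zero, mul_one, pow_succ]
  rw [mul_comm]
  congr 1
  exact Finset.prod_congr rfl fun k _ => by ring

lemma summable_norm_of_ratio {f ρ : ℕ → ℂ} {c : ℂ} (hc : ‖c‖ < 1) (hρ : Tendsto ρ atTop (𝓝 c))
    (h : ∀ n, f (n + 1) = ρ n * f n) : Summable fun n => ‖f n‖ := by
  obtain ⟨b, hb, hb1⟩ := exists_between hc
  refine summable_of_ratio_norm_eventually_le hb1 ?_
  filter_upwards [hρ.norm.eventually_lt_const hb] with n hn
  rw [norm_norm, norm_norm, h, norm_mul]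
  exact mul_le_mul_of_nonneg_right hn.le (norm_nonneg _)

lemma tendsto_ratio {Q : ℂ} (hQ1 : ‖Q‖ < 1) (z : ℂ) :
    Tendsto (fun n : ℕ => z / (1 - Q * Q ^ n)) atTop (𝓝 z) := by
  have h : Tendsto (fun n : ℕ => z / (1 - Q * Q ^ n)) atTop (𝓝 (z / (1 - Q * 0))) :=
    tendsto_const_nhds.div (tendsto_const_nhds.sub
      ((tendsto_pow_atTop_nhds_zero_of_norm_lt_one hQ1).const_mul Q)) (by simp)
  simpa using h

lemma qexp_succ (Q z : ℂ) (r : ℕ) :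
    qexp Q z (r + 1) = z / (1 - Q * Q ^ r) * qexp Q z r := by
  rw [qexp, qexp, qp_succ, pow_succ, div_mul_div_comm, mul_comm z, mul_comm (qp Q Q r)]

lemma summable_qexp {Q z : ℂ} (hQ1 : ‖Q‖ < 1) (hz : ‖z‖ < 1) :
    Summable fun r => ‖qexp Q z r‖ :=
  summable_norm_of_ratio hz (tendsto_ratio hQ1 z) (qexp_succ Q z)

lemma gauss_natCast_succ {Q : ℂ} (hQ : Q ≠ 0) (c : ℂ) (r : ℕ) :
    gauss Q c ((r + 1 : ℕ) : ℤ) = c * Q ^ r * gauss Q c r := by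
  simp only [gauss, Nat.cast_add, Nat.cast_one, tri_add, tri_one, zpow_add₀ hQ, mul_one, zpow_zero,
    zpow_natCast]
  rw [← Nat.cast_one, ← Nat.cast_add, zpow_natCast, pow_succ]
  ring

lemma summable_gauss_nat {Q : ℂ} (hQ : Q ≠ 0) (hQ1 : ‖Q‖ < 1) (c : ℂ) :
    Summable fun r : ℕ => ‖gauss Q c r‖ := by
  refine summable_norm_of_ratio (ρ := fun r => c * Q ^ r) (c := 0) (by simp) ?_
    (gauss_natCast_succ hQ c)
  simpa using (tendsto_pow_atTop_nhds_zero_of_norm_lt_one hQ1).const_mul c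

lemma euler_succ {Q : ℂ} (hQ : Q ≠ 0) (x : ℂ) (r : ℕ) :
    euler Q x (r + 1) = -x * Q ^ r / (1 - Q * Q ^ r) * euler Q x r := by
  rw [euler, euler, qp_succ, gauss_natCast_succ hQ, div_mul_div_comm, mul_comm (qp Q Q r)]

lemma summable_euler {Q : ℂ} (hQ : Q ≠ 0) (hQ1 : ‖Q‖ < 1) (x : ℂ) :
    Summable fun r => ‖euler Q x r‖ := by
  refine summable_norm_of_ratio (c := -x * 0) (by simp) ?_ (euler_succ hQ x)
  have h := ((tendsto_pow_atTop_nhds_zero_of_norm_lt_one hQ1).const_mul (-x)).mul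
    (tendsto_ratio hQ1 1)
  simpa [div_eq_mul_inv] using h

lemma gauss_neg {Q c : ℂ} (hQ : Q ≠ 0) (n : ℤ) :
    gauss Q c (-n) = gauss Q (Q / c) n := by
  have h : tri (-n) = n + tri n := by
    have h1 := two_mul_tri n
    have h2 := two_mul_tri (-n)
    linarith
  rw [gauss, gauss, h, zpow_add₀ hQ, div_zpow, zpow_neg]
  ring

lemma summable_gauss {Q : ℂ} (hQ : Q ≠ 0) (hQ1 : ‖Q‖ < 1) (c : ℂ) :
    Summable fun n : ℤ => ‖gauss Q c n‖ := by
  refine Summable.of_nat_of_neg (summable_gauss_nat hQ hQ1 c) ?_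
  simp only [gauss_neg hQ]
  exact summable_gauss_nat hQ hQ1 _

lemma tendsto_tsum_pow_mul {Q : ℂ} (hQ1 : ‖Q‖ < 1) {f : ℕ → ℂ} (hf : Summable fun r => ‖f r‖) :
    Tendsto (fun N : ℕ => ∑' r, (Q ^ N) ^ r * f r) atTop (𝓝 (f 0)) := by
  have h0 : ∑' r : ℕ, (if r = 0 then f 0 else 0) = f 0 := tsum_ite_eq 0 fun _ => f 0
  rw [← h0]
  refine tendsto_tsum_of_dominated_convergence hf (fun r => ?_) (Eventually.of_forall fun N r => ?_)
  · rcases eq_or_ne r 0 with rfl | hr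
    · simp
    · simp only [hr, if_false]
      have h := ((tendsto_pow_atTop_nhds_zero_of_norm_lt_one hQ1).pow r).mul_const (f r)
      simpa [hr] using h
  · rw [norm_mul, norm_pow, norm_pow]
    exact mul_le_of_le_one_left (norm_nonneg _)
      (pow_le_one₀ (by positivity) (pow_le_one₀ (norm_nonneg _) hQ1.le))

lemma euler_pow_mul (Q x : ℂ) (N r : ℕ) : euler Q (Q ^ N * x) r = (Q ^ N) ^ r * euler Q x r := by
  simp only [euler, gauss, zpow_natCast]
  rw [← mul_neg, mul_pow]
  ring

lemma qexp_pow_mul (Q z : ℂ) (N r : ℕ) : qexp Q (Q ^ N * z) r = (Q ^ N) ^ r * qexp Q z r := by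
  simp only [qexp, mul_pow]
  ring

lemma euler_zero (Q x : ℂ) : euler Q x 0 = 1 := by
  simp [euler, gauss, tri_zero, qp]

lemma qexp_zero (Q z : ℂ) : qexp Q z 0 = 1 := by
  simp [qexp, qp]

lemma tsum_euler_eq_mul {Q : ℂ} (hQ : Q ≠ 0) (hQ1 : ‖Q‖ < 1) (x : ℂ) :
    ∑' r, euler Q x r = (1 - x) * ∑' r, euler Q (Q * x) r := by
  have hs := (summable_euler hQ hQ1 x).of_norm
  have hs' := (summable_euler hQ hQ1 (Q * x)).of_norm
  have key : ∀ r, euler Q x (r + 1) = euler Q (Q * x) (r + 1) - x * euler Q (Q * x) r := by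
    intro r
    have h1 := euler_pow_mul Q x 1 (r + 1)
    have h2 := euler_pow_mul Q x 1 r
    rw [pow_one] at h1 h2
    rw [h1, h2, euler_succ hQ]
    have h3 := div_mul_cancel₀ (-x * Q ^ r) (one_sub_pow_ne_zero hQ1 r)
    linear_combination euler Q x r * h3
  rw [hs.tsum_eq_zero_add, hs'.tsum_eq_zero_add, euler_zero, euler_zero]
  simp only [key]
  rw [((summable_nat_add_iff 1).mpr hs').tsum_sub (hs'.mul_left x), tsum_mul_left,
    hs'.tsum_eq_zero_add, euler_zero]
  ring

lemma tsum_qexp_eq {Q z : ℂ} (hQ1 : ‖Q‖ < 1) (hz : ‖z‖ < 1) :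
    (1 - z) * ∑' r, qexp Q z r = ∑' r, qexp Q (Q * z) r := by
  have hQz : ‖Q * z‖ < 1 := by
    rw [norm_mul]; exact mul_lt_one_of_nonneg_of_lt_one_left (norm_nonneg _) hQ1 hz.le
  have hs := (summable_qexp hQ1 hz).of_norm
  have hs' := (summable_qexp hQ1 hQz).of_norm
  have key : ∀ r, qexp Q (Q * z) (r + 1) = qexp Q z (r + 1) - z * qexp Q z r := by
    intro r
    have h1 := qexp_pow_mul Q z 1 (r + 1)
    rw [pow_one] at h1
    rw [h1, qexp_succ]
    have := one_sub_pow_ne_zero hQ1 r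
    field_simp
    ring
  rw [hs'.tsum_eq_zero_add, qexp_zero]
  simp only [key]
  rw [((summable_nat_add_iff 1).mpr hs).tsum_sub (hs.mul_left z), tsum_mul_left,
    hs.tsum_eq_zero_add, qexp_zero]
  ring

lemma tsum_euler_eq_qp_mul {Q : ℂ} (hQ : Q ≠ 0) (hQ1 : ‖Q‖ < 1) (x : ℂ) (N : ℕ) :
    ∑' r, euler Q x r = qp Q x N * ∑' r, euler Q (Q ^ N * x) r := by
  induction N with
  | zero => simp [qp]
  | succ N ih =>
    rw [ih, qp_succ, tsum_euler_eq_mul hQ hQ1 (Q ^ N * x), pow_succ']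
    ring_nf

/-- Euler's expansion of `(x;Q)_∞`. -/
lemma tsum_euler {Q : ℂ} (hQ : Q ≠ 0) (hQ1 : ‖Q‖ < 1) (x : ℂ) :
    ∑' r, euler Q x r = qpInf Q x := by
  have h := (tendsto_qp hQ1 x).mul (tendsto_tsum_pow_mul hQ1 (summable_euler hQ hQ1 x))
  rw [euler_zero, mul_one] at h
  simp only [← euler_pow_mul, ← tsum_euler_eq_qp_mul hQ hQ1] at h
  exact tendsto_nhds_unique tendsto_const_nhds h

lemma qp_mul_tsum_qexp {Q z : ℂ} (hQ1 : ‖Q‖ < 1) (hz : ‖z‖ < 1) (N : ℕ) :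
    qp Q z N * ∑' r, qexp Q z r = ∑' r, qexp Q (Q ^ N * z) r := by
  induction N with
  | zero => simp [qp]
  | succ N ih =>
    have hN : ‖Q ^ N * z‖ < 1 := by
      rw [norm_mul, norm_pow]
      exact mul_lt_one_of_nonneg_of_lt_one_right (pow_le_one₀ (norm_nonneg _) hQ1.le)
        (norm_nonneg _) hz
    rw [qp_succ, mul_right_comm, ih, mul_comm, mul_comm z, tsum_qexp_eq hQ1 hN, pow_succ',
      mul_assoc]

/-- The `q`-exponential series is the inverse of `(z;Q)_∞`. -/
lemma qpInf_mul_tsum_qexp {Q z : ℂ} (hQ1 : ‖Q‖ < 1) (hz : ‖z‖ < 1) :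
    qpInf Q z * ∑' r, qexp Q z r = 1 := by
  have h := tendsto_tsum_pow_mul hQ1 (summable_qexp hQ1 hz)
  rw [qexp_zero] at h
  simp only [← qexp_pow_mul, ← qp_mul_tsum_qexp hQ1 hz] at h
  exact tendsto_nhds_unique ((tendsto_qp hQ1 z).mul_const _) h

lemma qp_mul_tsum_euler {Q : ℂ} (hQ : Q ≠ 0) (hQ1 : ‖Q‖ < 1) (n : ℕ) :
    qp Q Q n * ∑' r, euler Q (Q ^ ((n : ℤ) + 1)) r = qpInf Q Q := by
  rw [← tsum_euler hQ hQ1, tsum_euler_eq_qp_mul hQ hQ1 Q n, zpow_add₀ hQ, zpow_natCast, zpow_one]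

lemma tsum_euler_eq_zero {Q : ℂ} (hQ : Q ≠ 0) (hQ1 : ‖Q‖ < 1) {n : ℤ} (hn : n < 0) :
    ∑' r, euler Q (Q ^ (n + 1)) r = 0 := by
  obtain ⟨m, rfl⟩ : ∃ m : ℕ, n = -(m + 1) := ⟨(-n - 1).toNat, by omega⟩
  rw [tsum_euler_eq_qp_mul hQ hQ1 _ (m + 1), qp_succ]
  have : Q ^ (-((m : ℤ) + 1) + 1) * Q ^ m = 1 := by
    rw [← zpow_natCast Q m, ← zpow_add₀ hQ]; simp
  rw [this]; simp

lemma gauss_mul_euler {Q y : ℂ} (hQ : Q ≠ 0) (hy : y ≠ 0) (m : ℤ) (r : ℕ) :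
    gauss Q y m * euler Q (Q ^ (m + 1)) r = gauss Q y (m + r) * qexp Q (-(Q / y)) r := by
  have h : gauss Q (-Q ^ (m + 1)) r = y ^ (r : ℤ) * (-(Q / y)) ^ r * Q ^ (m * r) * Q ^ tri r := by
    rw [gauss, zpow_natCast, zpow_natCast, zpow_add₀ hQ, zpow_mul, zpow_natCast, zpow_one,
      ← mul_pow, ← mul_pow]
    congr 2
    field_simp
  rw [euler, h, gauss_add hQ hy, qexp, gauss, gauss]
  ring

lemma tsum_gauss_of_norm_lt {Q y : ℂ} (hQ : Q ≠ 0) (hQ1 : ‖Q‖ < 1) (hy : y ≠ 0)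
    (hQy : ‖Q / y‖ < 1) : ∑' n : ℤ, gauss Q y n = qpInf Q Q * theta Q (-y) := by
  have hz : ‖-(Q / y)‖ < 1 := by rwa [norm_neg]
  have hg := summable_gauss hQ hQ1 y
  have he := summable_qexp hQ1 hz
  let e : ℕ × ℤ ≃ ℕ × ℤ := Equiv.prodShear (Equiv.refl ℕ) fun r => Equiv.addRight (r : ℤ)
  have hY := summable_mul_of_summable_norm he hg
  have hX : Summable fun p : ℕ × ℤ => gauss Q y p.2 * euler Q (Q ^ (p.2 + 1)) p.1 := by
    refine (e.summable_iff.mpr hY).congr fun p => ?_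
    rw [gauss_mul_euler hQ hy, mul_comm]
    rfl
  have h1 : ∑' p : ℕ × ℤ, gauss Q y p.2 * euler Q (Q ^ (p.2 + 1)) p.1 =
      (∑' r, qexp Q (-(Q / y)) r) * ∑' n : ℤ, gauss Q y n := by
    rw [tsum_mul_tsum_of_summable_norm he hg,
      ← e.tsum_eq fun p => qexp Q (-(Q / y)) p.1 * gauss Q y p.2]
    refine tsum_congr fun p => ?_
    rw [gauss_mul_euler hQ hy, mul_comm]
    rfl
  have h2 : ∑' p : ℕ × ℤ, gauss Q y p.2 * euler Q (Q ^ (p.2 + 1)) p.1 =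
      qpInf Q Q * qpInf Q (-y) := by
    rw [← (Equiv.prodComm ℤ ℕ).tsum_eq]
    simp only [Equiv.prodComm_apply]
    rw [hX.prod_symm.tsum_prod]
    simp only [Prod.fst_swap, Prod.snd_swap, tsum_mul_left]
    rw [← (Nat.cast_injective (R := ℤ)).tsum_eq, ← tsum_euler hQ hQ1 (-y), ← tsum_mul_left]
    · refine tsum_congr fun n => ?_
      rw [← qp_mul_tsum_euler hQ hQ1 n, euler, neg_neg]
      field_simp [qp_ne_zero hQ1 n]
    · intro m hm
      by_contra hmem
      refine hm ?_
      change gauss Q y m * _ = 0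
      have : m < 0 := by
        by_contra h
        exact hmem ⟨m.toNat, by simpa using h⟩
      rw [tsum_euler_eq_zero hQ hQ1 this, mul_zero]
  have h3 := qpInf_mul_tsum_qexp hQ1 hz
  rw [h2] at h1
  rw [theta, div_neg, ← mul_assoc, h1]
  linear_combination (-∑' n : ℤ, gauss Q y n) * h3

lemma gauss_div {Q y : ℂ} (hQ : Q ≠ 0) (hy : y ≠ 0) (n : ℤ) :
    gauss Q (y / Q) (n + 1) = y / Q * gauss Q y n := by
  rw [gauss, gauss, tri_add, tri_one, zpow_add₀ (div_ne_zero hy hQ), div_zpow, zpow_one,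
    add_zero, mul_one, zpow_add₀ hQ]
  field_simp

lemma theta_div {Q y : ℂ} (hQ : Q ≠ 0) (hQ1 : ‖Q‖ < 1) (hy : y ≠ 0) :
    theta Q (-(y / Q)) = y / Q * theta Q (-y) := by
  rw [theta, theta, qpInf_eq_mul hQ1 (-(y / Q)), qpInf_eq_mul hQ1 (Q / -y)]
  have h1 : Q * -(y / Q) = -y := by field_simp
  have h2 : Q / -(y / Q) = Q * (Q / -y) := by field_simp
  rw [h1, h2]
  field_simp
  ring

/-- The Jacobi triple product identity. -/
lemma tsum_gauss {Q y : ℂ} (hQ : Q ≠ 0) (hQ1 : ‖Q‖ < 1) (hy : y ≠ 0) :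
    ∑' n : ℤ, gauss Q y n = qpInf Q Q * theta Q (-y) := by
  have key : ∀ (N : ℕ) (y : ℂ), y ≠ 0 → ‖Q ^ (N + 1) / y‖ < 1 →
      ∑' n : ℤ, gauss Q y n = qpInf Q Q * theta Q (-y) := by
    intro N
    induction N with
    | zero =>
      intro y hy h
      exact tsum_gauss_of_norm_lt hQ hQ1 hy (by simpa using h)
    | succ N ih =>
      intro y hy h
      have hyQ : y / Q ≠ 0 := div_ne_zero hy hQ
      have h1 := ih (y / Q) hyQ (by rwa [div_div_eq_mul_div, ← pow_succ])
      rw [theta_div hQ hQ1 hy, ← (Equiv.addRight (1 : ℤ)).tsum_eq] at h1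
      simp only [Equiv.coe_addRight, gauss_div hQ hy, tsum_mul_left] at h1
      apply mul_left_cancel₀ hyQ
      rw [h1]
      ring
  have hlim : Tendsto (fun N : ℕ => ‖Q ^ (N + 1) / y‖) atTop (𝓝 0) := by
    have h := ((tendsto_add_atTop_iff_nat 1).mpr
      (tendsto_pow_atTop_nhds_zero_of_norm_lt_one hQ1)).div_const y
    simpa using h.norm
  obtain ⟨N, hN⟩ := (hlim.eventually_lt_const one_pos).exists
  exact key N y hy hN

lemma norm_sq_lt_one {q : ℂ} (hq1 : ‖q‖ < 1) : ‖q ^ 2‖ < 1 := by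
  rw [norm_pow]; exact pow_lt_one₀ (norm_nonneg _) hq1 two_ne_zero

lemma qpInf_neg_one_mul {q : ℂ} (hq1 : ‖q‖ < 1) :
    qpInf q (-1) * qpInf (q ^ 2) q = 2 := by
  have hQ1 := norm_sq_lt_one hq1
  have h1 : qpInf q (-q) * qpInf q q = qpInf (q ^ 2) (q ^ 2) := by
    refine tendsto_nhds_unique ((tendsto_qp hq1 (-q)).mul (tendsto_qp hq1 q))
      ((tendsto_qp hQ1 (q ^ 2)).congr fun n => ?_)
    rw [qp, qp, qp, ← Finset.prod_mul_distrib]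
    exact Finset.prod_congr rfl fun k _ => by ring
  have h2 : qpInf (q ^ 2) q * qpInf (q ^ 2) (q ^ 2) = qpInf q q := by
    have hlim : Tendsto (fun n : ℕ => qp q q (2 * n)) atTop (𝓝 (qpInf q q)) :=
      (tendsto_qp hq1 q).comp (tendsto_id.const_mul_atTop' two_pos)
    refine tendsto_nhds_unique ((tendsto_qp hQ1 q).mul (tendsto_qp hQ1 (q ^ 2)))
      (hlim.congr fun n => ?_)
    induction n with
    | zero => simp [qp]
    | succ n ih =>
      rw [show 2 * (n + 1) = 2 * n + 1 + 1 by ring, qp_succ, qp_succ, ih, qp_succ, qp_succ]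
      ring
  have h3 : qpInf q q ≠ 0 := left_ne_zero_of_mul_eq_one (qpInf_mul_tsum_qexp hq1 hq1)
  have h4 : qpInf q (-1) = 2 * qpInf q (-q) := by
    rw [qpInf_eq_mul hq1, mul_neg_one]; ring
  apply mul_right_cancel₀ h3
  rw [h4]
  linear_combination 2 * qpInf (q ^ 2) q * h1 + 2 * h2

lemma qexp_mul_zpow_sq {q : ℂ} (hq : q ≠ 0) (n : ℤ) (r : ℕ) :
    qexp (q ^ 2) (-q) r * q ^ ((n + r) ^ 2) = q ^ (n ^ 2) * euler (q ^ 2) ((q ^ 2) ^ (n + 1)) r := by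
  have h : q ^ ((n + r) ^ 2) * q ^ r = q ^ (n ^ 2) * (q ^ 2) ^ ((n + 1) * r + tri r) := by
    rw [← zpow_natCast q r, ← zpow_natCast q 2, ← zpow_mul, ← zpow_add₀ hq, ← zpow_add₀ hq]
    congr 1
    push_cast
    linear_combination -two_mul_tri r
  rw [zpow_add₀ (pow_ne_zero 2 hq), zpow_mul, zpow_natCast] at h
  rw [qexp, euler, gauss, zpow_natCast, neg_pow, neg_pow ((q ^ 2) ^ (n + 1))]
  linear_combination (-1) ^ r / qp (q ^ 2) (q ^ 2) r * h

lemma tsum_qexp_mul_zpow_sq {q : ℂ} (hq : q ≠ 0) (n : ℤ) :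
    ∑' r : ℕ, qexp (q ^ 2) (-q) r * q ^ ((n + r) ^ 2) =
      q ^ (n ^ 2) * ∑' r, euler (q ^ 2) ((q ^ 2) ^ (n + 1)) r := by
  simp only [qexp_mul_zpow_sq hq, tsum_mul_left]

lemma tsum_qexp_mul_qexp_of_nonpos {q : ℂ} (hq : q ≠ 0) (hq1 : ‖q‖ < 1) {d : ℤ} (hd : d ≤ 0) :
    ∑' p : ℕ × ℕ, qexp (q ^ 2) (-q) p.1 * qexp (q ^ 2) (-q) p.2 * q ^ ((d - p.1 + p.2) ^ 2) =
      if d = 0 then qpInf (q ^ 2) (q ^ 2) else 0 := by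
  have hQ : q ^ 2 ≠ 0 := pow_ne_zero 2 hq
  have hQ1 := norm_sq_lt_one hq1
  have he := summable_qexp hQ1 (by rwa [norm_neg] : ‖-q‖ < 1)
  have hs : Summable fun p : ℕ × ℕ => qexp (q ^ 2) (-q) p.1 * qexp (q ^ 2) (-q) p.2 *
      q ^ ((d - p.1 + p.2) ^ 2) := by
    refine Summable.of_norm_bounded (he.mul_norm he) fun p => ?_
    rw [norm_mul]
    refine mul_le_of_le_one_right (norm_nonneg _) ?_
    rw [norm_zpow, ← Int.toNat_of_nonneg (sq_nonneg (d - p.1 + p.2)), zpow_natCast]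
    exact pow_le_one₀ (norm_nonneg _) hq1.le
  rw [hs.tsum_prod]
  simp only [mul_assoc, tsum_mul_left, tsum_qexp_mul_zpow_sq hq]
  rw [tsum_eq_single 0]
  · rcases hd.lt_or_eq with h | rfl
    · rw [tsum_euler_eq_zero hQ hQ1 (by simpa using h)]
      simp [h.ne]
    · have := qp_mul_tsum_euler hQ hQ1 0
      simpa [qexp_zero, qp] using this
  · intro r hr
    rw [tsum_euler_eq_zero hQ hQ1 (by omega)]
    simp

lemma tsum_qexp_mul_qexp {q : ℂ} (hq : q ≠ 0) (hq1 : ‖q‖ < 1) (d : ℤ) :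
    ∑' p : ℕ × ℕ, qexp (q ^ 2) (-q) p.1 * qexp (q ^ 2) (-q) p.2 * q ^ ((d - p.1 + p.2) ^ 2) =
      if d = 0 then qpInf (q ^ 2) (q ^ 2) else 0 := by
  rcases le_total d 0 with hd | hd
  · exact tsum_qexp_mul_qexp_of_nonpos hq hq1 hd
  · have h := tsum_qexp_mul_qexp_of_nonpos hq hq1 (neg_nonpos.mpr hd)
    simp only [neg_eq_zero] at h
    rw [← h, ← (Equiv.prodComm ℕ ℕ).tsum_eq]
    refine tsum_congr fun p => ?_
    simp only [Equiv.prodComm_apply, Prod.fst_swap, Prod.snd_swap]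
    rw [mul_comm (qexp _ _ p.2)]
    congr 2
    ring

lemma norm_gauss_le {Q : ℂ} (hQ : Q ≠ 0) (hQ1 : ‖Q‖ < 1) (c : ℂ) (n : ℤ) :
    ‖gauss Q c n‖ ≤ ∑' m : ℤ, ‖gauss Q c m‖ :=
  (summable_gauss hQ hQ1 c).le_tsum n fun _ _ => norm_nonneg _

/-- The correlation of two translates of a Gaussian sequence. -/
noncomputable def corr (q ω : ℂ) (α β : ℤ) : ℂ :=
  ∑' n : ℤ, gauss q ω (n + α) * gauss q ω (n + β)

lemma corr_neg (q ω : ℂ) (α β : ℤ) : corr q ω (-α) (-β) = corr q ω α β := by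
  rw [corr, corr, ← (Equiv.addRight (α + β)).tsum_eq]
  refine tsum_congr fun n => ?_
  rw [mul_comm, Equiv.coe_addRight]
  congr 2 <;> ring

lemma gauss_add_mul_gauss_sub {q ω : ℂ} (hq : q ≠ 0) (hω : ω ≠ 0) (s t : ℤ) :
    gauss q ω (s + t) * gauss q ω (s - t) = q ^ (t ^ 2) * gauss (q ^ 2) (ω ^ 2) s := by
  have h1 : ω ^ (s + t) * ω ^ (s - t) = (ω ^ 2) ^ s := by
    rw [← zpow_natCast ω 2, ← zpow_mul, ← zpow_add₀ hω]
    congr 1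
    push_cast
    ring
  have h2 : q ^ tri (s + t) * q ^ tri (s - t) = q ^ (t ^ 2) * (q ^ 2) ^ tri s := by
    rw [← zpow_natCast q 2, ← zpow_mul, ← zpow_add₀ hq, ← zpow_add₀ hq]
    congr 1
    have h3 := two_mul_tri (s + t)
    have h4 := two_mul_tri (s - t)
    have h5 := two_mul_tri s
    push_cast
    linarith
  rw [gauss, gauss, gauss]
  linear_combination q ^ tri (s + t) * q ^ tri (s - t) * h1 + (ω ^ 2) ^ s * h2

lemma corr_eq {q ω : ℂ} (hq : q ≠ 0) (hω : ω ≠ 0) {α β t : ℤ} (h : α - β = 2 * t) :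
    corr q ω α β = q ^ (t ^ 2) * ∑' n : ℤ, gauss (q ^ 2) (ω ^ 2) n := by
  rw [corr, ← tsum_mul_left, ← (Equiv.addRight (β + t)).tsum_eq fun n : ℤ => q ^ (t ^ 2) * _]
  refine tsum_congr fun n => ?_
  rw [Equiv.coe_addRight, ← gauss_add_mul_gauss_sub hq hω]
  congr 2 <;> linarith

lemma hasSum_corr {ι : Type*} {q ω : ℂ} (hq : q ≠ 0) (hq1 : ‖q‖ < 1) {w : ι → ℂ}
    (hw : Summable fun i => ‖w i‖) (α β : ι → ℤ) :
    HasSum (fun n : ℤ => ∑' i, w i * (gauss q ω (n + α i) * gauss q ω (n + β i)))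
      (∑' i, w i * corr q ω (α i) (β i)) := by
  have hg := summable_gauss hq hq1 ω
  let e : ι × ℤ ≃ ι × ℤ := Equiv.prodShear (Equiv.refl ι) fun i => Equiv.addRight (α i)
  have hY : Summable fun p : ι × ℤ =>
      w p.1 * (gauss q ω p.2 * gauss q ω (p.2 + (β p.1 - α p.1))) := by
    refine Summable.of_norm_bounded
      ((hw.mul_norm hg).mul_right (∑' m : ℤ, ‖gauss q ω m‖)) fun p => ?_
    rw [← mul_assoc, norm_mul, norm_mul]
    exact mul_le_mul_of_nonneg_left (norm_gauss_le hq hq1 ω _) (by positivity)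
  have hX : Summable fun p : ι × ℤ =>
      w p.1 * (gauss q ω (p.2 + α p.1) * gauss q ω (p.2 + β p.1)) := by
    refine (e.summable_iff.mpr hY).congr fun p => ?_
    have : p.2 + α p.1 + (β p.1 - α p.1) = p.2 + β p.1 := by ring
    rw [← this]
    rfl
  have h := hX.prod_symm.hasSum.prod_fiberwise fun n => (hX.prod_symm.prod_factor n).hasSum
  have hval : ∑' p : ℤ × ι, w p.swap.1 *
      (gauss q ω (p.swap.2 + α p.swap.1) * gauss q ω (p.swap.2 + β p.swap.1)) =
      ∑' i, w i * corr q ω (α i) (β i) := by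
    have h1 := (Equiv.prodComm ℤ ι).tsum_eq fun p : ι × ℤ =>
      w p.1 * (gauss q ω (p.2 + α p.1) * gauss q ω (p.2 + β p.1))
    simp only [Equiv.prodComm_apply] at h1
    rw [h1, hX.tsum_prod]
    simp only [tsum_mul_left, corr]
  rwa [hval] at h

/-- The product of two sums of Gaussian values weighted by `q`-exponential coefficients, as a
double sum. -/
lemma tsum_mul_tsum_qexp_gauss {q ω z : ℂ} (hq : q ≠ 0) (hq1 : ‖q‖ < 1) (hz : ‖z‖ < 1)
    (u v : ℕ → ℤ) :
    (∑' r, qexp (q ^ 2) z r * gauss q ω (u r)) * (∑' r, qexp (q ^ 2) z r * gauss q ω (v r)) =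
      ∑' p : ℕ × ℕ, qexp (q ^ 2) z p.1 * qexp (q ^ 2) z p.2 *
        (gauss q ω (u p.1) * gauss q ω (v p.2)) := by
  have hs : ∀ u : ℕ → ℤ, Summable fun r => ‖qexp (q ^ 2) z r * gauss q ω (u r)‖ := fun u => by
    refine Summable.of_nonneg_of_le (fun r => norm_nonneg _) (fun r => ?_)
      ((summable_qexp (norm_sq_lt_one hq1) hz).mul_right (∑' m : ℤ, ‖gauss q ω m‖))
    rw [norm_mul]
    exact mul_le_mul_of_nonneg_left (norm_gauss_le hq hq1 ω _) (norm_nonneg _)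
  rw [tsum_mul_tsum_of_summable_norm (hs u) (hs v)]
  exact tsum_congr fun p => by ring

lemma pow_two_mul_pred {q : ℂ} (r : ℕ) :
    q ^ (2 * (r * (r - 1))) = q ^ (2 * ((r : ℤ) * (r - 1))) := by
  rw [← zpow_natCast]
  congr 1
  cases r <;> simp

lemma phi_term_exponent (n k : ℤ) (r : ℤ) :
    tri n + n * k + tri k + 2 * (r * (r - 1)) + (-2 * k + 4 - 2 * n) * r =
      tri (n + (k - 2 * r)) + r := by
  have h1 := two_mul_tri n
  have h2 := two_mul_tri k
  have h3 := two_mul_tri (n + (k - 2 * r))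
  linarith

lemma phi_mul_pow {q : ℝ} {ω : ℂ} (hq : (q : ℂ) ≠ 0) (hω : ω ≠ 0) (n k : ℤ) :
    ω ^ n * (q : ℂ) ^ tri n * phi q (ω * (q : ℂ) ^ n) k =
      qpInf q (-1) * ∑' r : ℕ, qexp ((q : ℂ) ^ 2) (-q) r * gauss q ω (n + (k - 2 * r)) := by
  rw [phi, ← tri, mul_assoc (qpInf _ _), mul_assoc (qpInf _ _), mul_left_comm, ← tsum_mul_left,
    ← tsum_mul_left]
  congr 1
  refine tsum_congr fun r => ?_
  have hx : (-((q : ℂ) ^ (-2 * k + 4)) * (ω * (q : ℂ) ^ n) ^ (-2 : ℤ)) ^ r =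
      (-1) ^ r * ω ^ (-2 * (r : ℤ)) * (q : ℂ) ^ ((-2 * k + 4 - 2 * n) * r) := by
    rw [neg_mul, neg_pow, mul_zpow, mul_left_comm, ← zpow_mul, ← zpow_add₀ hq, mul_pow,
      zpow_mul, zpow_natCast, zpow_mul, zpow_natCast]
    ring_nf
  have hqp : (q : ℂ) ^ tri n * (q : ℂ) ^ (n * k) * (q : ℂ) ^ tri k *
      (q : ℂ) ^ (2 * ((r : ℤ) * (r - 1))) * (q : ℂ) ^ ((-2 * k + 4 - 2 * n) * r) =
      (q : ℂ) ^ tri (n + (k - 2 * r)) * (q : ℂ) ^ r := by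
    rw [← zpow_natCast (q : ℂ) r]
    simp only [← zpow_add₀ hq]
    rw [phi_term_exponent]
  have hωp : ω ^ n * ω ^ k * ω ^ (-2 * (r : ℤ)) = ω ^ (n + (k - 2 * r)) := by
    rw [← zpow_add₀ hω, ← zpow_add₀ hω]
    congr 1
    ring
  rw [hx, pow_two_mul_pred, mul_zpow, ← zpow_mul, qexp, neg_pow (q : ℂ), gauss, ← hωp]
  linear_combination (ω ^ n * ω ^ k * ω ^ (-2 * (r : ℤ)) * (-1) ^ r /
    qp ((q : ℂ) ^ 2) ((q : ℂ) ^ 2) r) * hqp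

lemma phi_neg_inv_term_exponent (n k : ℤ) (r : ℤ) :
    tri n + (-n + 1) * k + tri k + 2 * (r * (r - 1)) + (-2 * k + 2 + 2 * n) * r =
      tri (n - (k - 2 * r)) + r := by
  have h1 := two_mul_tri n
  have h2 := two_mul_tri k
  have h3 := two_mul_tri (n - (k - 2 * r))
  linarith

lemma phi_neg_inv_mul_pow {q : ℝ} {ω : ℂ} (hq : (q : ℂ) ≠ 0) (hω : ω ≠ 0) (n k : ℤ) :
    ω ^ n * (q : ℂ) ^ tri n * phi q (-ω⁻¹ * (q : ℂ) ^ (-n + 1)) k =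
      qpInf q (-1) * (-1) ^ k *
        ∑' r : ℕ, qexp ((q : ℂ) ^ 2) (-q) r * gauss q ω (n + -(k - 2 * r)) := by
  rw [phi, ← tri, mul_assoc (qpInf _ _), mul_assoc (qpInf _ _),
    mul_assoc (qpInf _ _), mul_left_comm (ω ^ n * _),
    ← tsum_mul_left (a := (-1 : ℂ) ^ k), ← tsum_mul_left, ← tsum_mul_left]
  congr 1
  refine tsum_congr fun r => ?_
  have hx : (-((q : ℂ) ^ (-2 * k + 4)) * (-ω⁻¹ * (q : ℂ) ^ (-n + 1)) ^ (-2 : ℤ)) ^ r =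
      (-1) ^ r * ω ^ (2 * (r : ℤ)) * (q : ℂ) ^ ((-2 * k + 2 + 2 * n) * r) := by
    rw [neg_mul, neg_pow, mul_zpow, Even.neg_zpow (by decide), inv_zpow', mul_left_comm,
      ← zpow_mul, ← zpow_add₀ hq, mul_pow, zpow_mul, zpow_natCast, zpow_mul, zpow_natCast]
    ring_nf
  have hqp : (q : ℂ) ^ tri n * (q : ℂ) ^ ((-n + 1) * k) * (q : ℂ) ^ tri k *
      (q : ℂ) ^ (2 * ((r : ℤ) * (r - 1))) * (q : ℂ) ^ ((-2 * k + 2 + 2 * n) * r) =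
      (q : ℂ) ^ tri (n - (k - 2 * r)) * (q : ℂ) ^ r := by
    rw [← zpow_natCast (q : ℂ) r]
    simp only [← zpow_add₀ hq]
    rw [phi_neg_inv_term_exponent]
  have hωp : ω ^ n * ω ^ (-k) * ω ^ (2 * (r : ℤ)) = ω ^ (n - (k - 2 * r)) := by
    rw [← zpow_add₀ hω, ← zpow_add₀ hω]
    congr 1
    ring
  have hneg : (-ω⁻¹) ^ k = (-1) ^ k * ω ^ (-k) := by
    rw [← neg_one_mul, mul_zpow, inv_zpow']
  rw [hx, pow_two_mul_pred, mul_zpow, ← zpow_mul, hneg, qexp, neg_pow (q : ℂ), gauss,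
    ← sub_eq_add_neg, ← hωp]
  linear_combination (ω ^ n * (-1) ^ k * ω ^ (-k) * ω ^ (2 * (r : ℤ)) * (-1) ^ r /
    qp ((q : ℂ) ^ 2) ((q : ℂ) ^ 2) r) * hqp

lemma tsum_qexp_mul_corr {q ω : ℂ} (hq : q ≠ 0) (hq1 : ‖q‖ < 1) (hω : ω ≠ 0) (k l : ℤ) :
    (1 + (-1) ^ (k + l)) * ∑' p : ℕ × ℕ, qexp (q ^ 2) (-q) p.1 * qexp (q ^ 2) (-q) p.2 *
        corr q ω (k - 2 * p.1) (l - 2 * p.2) =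
      if k = l then 2 * qpInf (q ^ 2) (q ^ 2) ^ 2 * theta (q ^ 2) (-ω ^ 2) else 0 := by
  rcases Int.even_or_odd (k - l) with ⟨d, hd⟩ | hodd
  · have hkl : k = l ↔ d = 0 := by omega
    have hsign : (-1 : ℂ) ^ (k + l) = 1 := Even.neg_one_zpow ⟨l + d, by omega⟩
    have hcorr : ∀ p : ℕ × ℕ, corr q ω (k - 2 * p.1) (l - 2 * p.2) =
        q ^ ((d - p.1 + p.2) ^ 2) * ∑' n : ℤ, gauss (q ^ 2) (ω ^ 2) n :=
      fun p => corr_eq hq hω (by linarith)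
    simp only [hcorr, ← mul_assoc, tsum_mul_right, tsum_qexp_mul_qexp hq hq1, hkl, hsign,
      tsum_gauss (pow_ne_zero 2 hq) (norm_sq_lt_one hq1) (pow_ne_zero 2 hω)]
    split_ifs <;> ring
  · have hkl : k ≠ l := by rintro rfl; simp at hodd
    have hsign : (-1 : ℂ) ^ (k + l) = -1 := by
      refine Odd.neg_one_zpow ?_
      rw [Int.odd_sub] at hodd
      rw [Int.odd_add]
      exact hodd
    rw [hsign, if_neg hkl]
    simp

theorem stmt_9 (q : ℝ) (hq0 : 0 < q) (hq1 : q < 1) (ω : ℝ) (hω : ω ≠ 0) (k l : ℤ) :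
    HasSum (fun n : ℤ => (ω : ℂ) ^ (2 * n) * (q : ℂ) ^ (n * (n - 1)) *
        (phi q ((ω : ℂ) * (q : ℂ) ^ n) k * phi q ((ω : ℂ) * (q : ℂ) ^ n) l +
          phi q (-(ω : ℂ)⁻¹ * (q : ℂ) ^ (-n + 1)) k * phi q (-(ω : ℂ)⁻¹ * (q : ℂ) ^ (-n + 1)) l))
      ((if k = l then 1 else 0) *
        (8 * (qpInf ((q : ℂ) ^ 2) ((q : ℂ) ^ 2) ^ 2 / qpInf ((q : ℂ) ^ 2) (q : ℂ) ^ 2) *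
          theta ((q : ℂ) ^ 2) (-(ω : ℂ) ^ 2))) := by
  have hq : (q : ℂ) ≠ 0 := by exact_mod_cast hq0.ne'
  have hq1' : ‖(q : ℂ)‖ < 1 := by rwa [Complex.norm_real, Real.norm_of_nonneg hq0.le]
  have hω' : (ω : ℂ) ≠ 0 := by exact_mod_cast hω
  have hz : ‖-(q : ℂ)‖ < 1 := by rwa [norm_neg]
  have he := summable_qexp (norm_sq_lt_one hq1') hz
  have h1 := hasSum_corr (ω := (ω : ℂ)) hq hq1' (he.mul_norm he)
    (fun p => k - 2 * (p.1 : ℤ)) (fun p => l - 2 * (p.2 : ℤ))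
  have h2 := hasSum_corr (ω := (ω : ℂ)) hq hq1' (he.mul_norm he)
    (fun p => -(k - 2 * (p.1 : ℤ))) (fun p => -(l - 2 * (p.2 : ℤ)))
  simp only [corr_neg] at h2
  have h3 := (h1.add (h2.mul_left ((-1) ^ (k + l)))).mul_left (qpInf (q : ℂ) (-1) ^ 2)
  rw [← one_add_mul, tsum_qexp_mul_corr hq hq1' hω'] at h3
  have hC := qpInf_neg_one_mul hq1'
  have hne : qpInf ((q : ℂ) ^ 2) (q : ℂ) ≠ 0 := by
    intro h
    rw [h, mul_zero] at hC
    exact two_ne_zero hC.symm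
  have hval : (if k = l then (1 : ℂ) else 0) *
      (8 * (qpInf ((q : ℂ) ^ 2) ((q : ℂ) ^ 2) ^ 2 / qpInf ((q : ℂ) ^ 2) (q : ℂ) ^ 2) *
        theta ((q : ℂ) ^ 2) (-(ω : ℂ) ^ 2)) =
      qpInf (q : ℂ) (-1) ^ 2 * if k = l then
        2 * qpInf ((q : ℂ) ^ 2) ((q : ℂ) ^ 2) ^ 2 * theta ((q : ℂ) ^ 2) (-(ω : ℂ) ^ 2) else 0 := by
    split_ifs
    · field_simp
      linear_combination (-2 * qpInf ((q : ℂ) ^ 2) ((q : ℂ) ^ 2) ^ 2 *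
        theta ((q : ℂ) ^ 2) (-(ω : ℂ) ^ 2) *
        (qpInf (q : ℂ) (-1) * qpInf ((q : ℂ) ^ 2) (q : ℂ) + 2)) * hC
    · simp
  rw [hval]
  refine (congrArg (fun f => HasSum f _) (funext fun n => ?_)).mpr h3
  have hw : (ω : ℂ) ^ (2 * n) * (q : ℂ) ^ (n * (n - 1)) =
      ((ω : ℂ) ^ n * (q : ℂ) ^ tri n) ^ 2 := by
    rw [← two_mul_tri, mul_comm 2 n, mul_comm 2 (tri n), zpow_mul, zpow_mul, mul_pow]
    norm_cast
  have e1 := phi_mul_pow hq hω' n k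
  have e2 := phi_mul_pow hq hω' n l
  have e3 := phi_neg_inv_mul_pow hq hω' n k
  have e4 := phi_neg_inv_mul_pow hq hω' n l
  rw [← tsum_mul_tsum_qexp_gauss hq hq1' hz (fun r => n + (k - 2 * (r : ℤ)))
      (fun r => n + (l - 2 * (r : ℤ))),
    ← tsum_mul_tsum_qexp_gauss hq hq1' hz (fun r => n + -(k - 2 * (r : ℤ)))
      (fun r => n + -(l - 2 * (r : ℤ))), hw,
    zpow_add₀ (by norm_num : (-1 : ℂ) ≠ 0)]
  have e5 := congrArg₂ (· * ·) e1 e2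
  have e6 := congrArg₂ (· * ·) e3 e4
  linear_combination e5 + e6
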